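/- Every connected cubic simple graph G on n vertices admits a tour of length at most (4/3 − 1/183711)·(n − n0 + 2b), where b is the number of bridges of G and n0 is the number of vertices of G all of whose incident edges are bridges. -/

import Mathlib

open SimpleGraph

namespace CubicTour

open Classical in
/-- A closed walk with vertex set exactly `S`, using each edge at most twice,
of length at most `k + |S| - 2`. -/
def Tour {V : Type*} (G : SimpleGraph V) (S : Finset V) (k : ℕ) : Prop :=
  ∃ (a : V) (T : G.Walk a a), (∀ u, u ∈ T.support ↔ u ∈ S) ∧
    (∀ e : Sym2 V, T.edges.count e ≤ 2) ∧ T.length + 2 ≤ k + S.card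

open Classical in
/-- `S` is covered by disjoint closed walks of total cost `k`. -/
inductive CC {V : Type*} (G : SimpleGraph V) : Finset V → ℕ → Prop
  | empty : CC G ∅ 0
  | add {S S' : Finset V} {k k' : ℕ} : Tour G S k → CC G S' k' → Disjoint S S' →
      CC G (S ∪ S') (k + k')

open Classical in
/-- `S` is covered by a path from `a` to `b` and disjoint closed walks of total cost `k`. -/
def PC {V : Type*} (G : SimpleGraph V) (S : Finset V) (a b : V) (k : ℕ) : Prop :=
  ∃ (P : G.Walk a b) (R : Finset V), P.IsPath ∧ Disjoint P.support.toFinset R ∧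
    S = P.support.toFinset ∪ R ∧ CC G R k

section covers
open Classical

variable {V : Type*} {G : SimpleGraph V}

theorem CC.union {S R : Finset V} {k l : ℕ} (h : CC G S k) (h' : CC G R l)
    (hd : Disjoint S R) : CC G (S ∪ R) (k + l) := by
  induction h with
  | empty => simpa using h'
  | @add S S' k k' ht hc hd' ih =>
    rw [Finset.disjoint_union_left] at hd
    rw [Finset.union_assoc, add_assoc]
    refine CC.add ht (ih hd.2) ?_
    rw [Finset.disjoint_union_right]
    exact ⟨hd', hd.1⟩

theorem Tour.cc {S : Finset V} {k : ℕ} (h : Tour G S k) : CC G S k := by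
  simpa using CC.add h CC.empty (by simp)

theorem CC.single (x : V) : CC G {x} 1 := by
  refine Tour.cc ⟨x, Walk.nil, ?_, ?_, ?_⟩ <;> simp

theorem PC.single (x : V) : PC G {x} x x 0 := by
  refine ⟨Walk.nil, ∅, ?_, ?_, ?_, CC.empty⟩ <;> simp

theorem PC.symm {S : Finset V} {a b : V} {k : ℕ} (h : PC G S a b k) : PC G S b a k := by
  obtain ⟨P, R, h1, h2, h3, h4⟩ := h
  refine ⟨P.reverse, R, h1.reverse, ?_, ?_, h4⟩ <;> simpa

theorem PC.add {S R : Finset V} {a b : V} {k l : ℕ} (h : PC G S a b k) (h' : CC G R l)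
    (hd : Disjoint S R) : PC G (S ∪ R) a b (k + l) := by
  obtain ⟨P, R', h1, h2, h3, h4⟩ := h
  subst h3
  rw [Finset.disjoint_union_left] at hd
  refine ⟨P, R' ∪ R, h1, ?_, by rw [Finset.union_assoc], h4.union h' hd.2⟩
  rw [Finset.disjoint_union_right]
  exact ⟨h2, hd.1⟩

theorem PC.concat {S R : Finset V} {a b x y : V} {k l : ℕ} (h : PC G S a x k)
    (hxy : G.Adj x y) (h' : PC G R y b l)
    (hd : Disjoint S R) : PC G (S ∪ R) a b (k + l) := by
  obtain ⟨P, R1, h1, h2, h3, h4⟩ := h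
  obtain ⟨Q, R2, g1, g2, g3, g4⟩ := h'
  subst h3
  subst g3
  simp only [Finset.disjoint_union_left, Finset.disjoint_union_right] at hd
  obtain ⟨⟨d1, d2⟩, d3, d4⟩ := hd
  have hs : (P.append (Walk.cons hxy Q)).support = P.support ++ Q.support := by
    rw [Walk.support_append]; simp
  refine ⟨P.append (Walk.cons hxy Q), R1 ∪ R2, ?_, ?_, ?_, h4.union g4 d4⟩
  · rw [Walk.isPath_def, hs, List.nodup_append']
    refine ⟨h1.support_nodup, g1.support_nodup, ?_⟩
    intro z hz hz'
    exact Finset.disjoint_left.1 d1 (by simpa using hz) (by simpa using hz')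
  · rw [hs, List.toFinset_append]
    simp only [Finset.disjoint_union_left, Finset.disjoint_union_right]
    exact ⟨⟨h2, d2.symm⟩, d3, g2⟩
  · rw [hs, List.toFinset_append]
    ext z
    simp only [Finset.mem_union]
    tauto

theorem PC.close {S : Finset V} {a b : V} {k : ℕ} (h : PC G S a b k)
    (hab : G.Adj a b) : CC G S (k + 2) := by
  obtain ⟨P, R, h1, h2, h3, h4⟩ := h
  subst h3
  rw [add_comm]
  refine CC.add ⟨b, Walk.cons hab.symm P, ?_, ?_, ?_⟩ h4 h2
  · intro u
    simp only [Walk.support_cons, List.mem_cons, List.mem_toFinset]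
    constructor
    · rintro (rfl | h)
      · exact P.end_mem_support
      · exact h
    · exact Or.inr
  · intro e
    rw [Walk.edges_cons, List.count_cons]
    have := List.nodup_iff_count_le_one.1 h1.isTrail.edges_nodup e
    split_ifs <;> omega
  · rw [List.toFinset_card_of_nodup h1.support_nodup, Walk.length_support]
    simp; omega

theorem Tour.mono {G' : SimpleGraph V} (hG : G ≤ G') {S : Finset V} {k : ℕ}
    (h : Tour G S k) : Tour G' S k := by
  obtain ⟨a, T, h1, h2, h3⟩ := h
  refine ⟨a, T.mapLe hG, ?_, ?_, ?_⟩
  · simpa using h1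
  · simpa using h2
  · simpa using h3

theorem CC.mono {G' : SimpleGraph V} (hG : G ≤ G') {S : Finset V} {k : ℕ}
    (h : CC G S k) : CC G' S k := by
  induction h with
  | empty => exact CC.empty
  | add ht hc hd ih => exact CC.add (ht.mono hG) ih hd

theorem PC.mono {G' : SimpleGraph V} (hG : G ≤ G') {S : Finset V} {a b : V} {k : ℕ}
    (h : PC G S a b k) : PC G' S a b k := by
  obtain ⟨P, R, h1, h2, h3, h4⟩ := h
  refine ⟨P.mapLe hG, R, h1.mapLe hG, ?_, ?_, h4.mono hG⟩ <;> simpa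

theorem Tour.merge {S R : Finset V} {k l : ℕ} (hS : Tour G S k) (hR : Tour G R l)
    (hd : Disjoint S R) {x y : V} (hx : x ∈ S) (hy : y ∈ R) (hxy : G.Adj x y) :
    Tour G (S ∪ R) (k + l) := by
  obtain ⟨a, T, h1, h2, h3⟩ := hS
  obtain ⟨b, U, g1, g2, g3⟩ := hR
  have hxT := (h1 x).2 hx
  have hyU := (g1 y).2 hy
  have cT : ∀ e, (T.rotate x hxT).edges.count e = T.edges.count e := fun e =>
    (T.rotate_edges x hxT).perm.count_eq e
  have cU : ∀ e, (U.rotate y hyU).edges.count e = U.edges.count e := fun e =>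
    (U.rotate_edges y hyU).perm.count_eq e
  have eT : ∀ p q, s(p, q) ∈ T.edges → p ∈ S ∧ q ∈ S := fun p q h =>
    ⟨(h1 p).1 (T.fst_mem_support_of_mem_edges h), (h1 q).1 (T.snd_mem_support_of_mem_edges h)⟩
  have eU : ∀ p q, s(p, q) ∈ U.edges → p ∈ R ∧ q ∈ R := fun p q h =>
    ⟨(g1 p).1 (U.fst_mem_support_of_mem_edges h), (g1 q).1 (U.snd_mem_support_of_mem_edges h)⟩
  have hxR : x ∉ R := fun h => Finset.disjoint_left.1 hd hx h
  have hyS : y ∉ S := fun h => Finset.disjoint_left.1 hd h hy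
  refine ⟨x, (T.rotate x hxT).append
    (Walk.cons hxy ((U.rotate y hyU).append (Walk.cons hxy.symm Walk.nil))), ?_, ?_, ?_⟩
  · intro u
    simp only [Walk.mem_support_append_iff, Walk.mem_support_rotate_iff, Walk.support_cons,
      List.mem_cons, h1, g1, Walk.support_nil, List.not_mem_nil, or_false, Finset.mem_union]
    constructor
    · rintro (h | rfl | h | rfl | rfl) <;> simp [*]
    · tauto
  · intro e
    induction e using Sym2.ind with
    | _ p q =>
    simp only [Walk.edges_append, Walk.edges_cons, List.count_append, List.count_cons, cT, cU,
      Walk.edges_nil, List.count_nil]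
    have a1 := h2 s(p, q)
    have a2 := g2 s(p, q)
    have hsw : s(y, x) = s(x, y) := Sym2.eq_swap
    rw [hsw]
    by_cases he : s(x, y) = s(p, q)
    · have b1 : T.edges.count s(p, q) = 0 := by
        rw [List.count_eq_zero, ← he]
        intro h; exact hyS (eT _ _ h).2
      have b2 : U.edges.count s(p, q) = 0 := by
        rw [List.count_eq_zero, ← he]
        intro h; exact hxR (eU _ _ h).1
      simp [he, b1, b2]
    · simp only [beq_iff_eq, he, if_false]
      by_cases hT : s(p, q) ∈ T.edges
      · have b2 : U.edges.count s(p, q) = 0 := by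
          rw [List.count_eq_zero]
          intro h
          exact Finset.disjoint_left.1 hd (eT _ _ hT).1 (eU _ _ h).1
        omega
      · rw [← List.count_eq_zero] at hT
        omega
  · rw [Finset.card_union_of_disjoint hd]
    simp
    omega

theorem CC.extract {R : Finset V} {k : ℕ} (h : CC G R k) : ∀ {y : V}, y ∈ R →
    ∃ S1 k1 R' k', y ∈ S1 ∧ Tour G S1 k1 ∧ CC G R' k' ∧ Disjoint S1 R' ∧ R = S1 ∪ R' ∧
      k = k1 + k' := by
  induction h with
  | empty => intro y hy; simp at hy
  | @add S S' k k' ht hc hd ih =>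
    intro y hy
    rcases Finset.mem_union.1 hy with h | h
    · exact ⟨S, k, S', k', h, ht, hc, hd, rfl, rfl⟩
    · obtain ⟨S1, k1, R', l', e1, e2, e3, e4, e5, e6⟩ := ih h
      subst e5
      rw [Finset.disjoint_union_right] at hd
      refine ⟨S1, k1, S ∪ R', k + l', e1, e2, CC.add ht e3 hd.2, ?_, ?_, by omega⟩
      · rw [Finset.disjoint_union_right]; exact ⟨hd.1.symm, e4⟩
      · ext z; simp only [Finset.mem_union]; tauto

theorem CC.glue [Fintype V] (hconn : ∀ X : Finset V, X.Nonempty → X ≠ Finset.univ →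
    ∃ x ∈ X, ∃ y, y ∉ X ∧ G.Adj x y) : ∀ n : ℕ, ∀ (S R : Finset V) (k l : ℕ), R.card = n →
    Tour G S k → S.Nonempty → CC G R l → Disjoint S R → S ∪ R = Finset.univ →
    Tour G Finset.univ (k + l) := by
  intro n
  induction n using Nat.strong_induction_on with
  | _ n ih =>
  intro S R k l hn hS hne hR hd hu
  by_cases hSu : S = Finset.univ
  · subst hSu
    obtain ⟨a, T, h1, h2, h3⟩ := hS
    exact ⟨a, T, h1, h2, by omega⟩
  · obtain ⟨x, hx, y, hy, hxy⟩ := hconn S hne hSu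
    have hyR : y ∈ R := by
      have : y ∈ S ∪ R := by rw [hu]; simp
      simpa [hy] using this
    obtain ⟨S1, k1, R', k', e1, e2, e3, e4, e5, e6⟩ := hR.extract hyR
    subst e5
    have hd' := hd
    rw [Finset.disjoint_union_right] at hd'
    have := ih R'.card (by
      rw [← hn, Finset.card_union_of_disjoint e4]
      have : 0 < S1.card := Finset.card_pos.2 ⟨y, e1⟩
      omega) (S ∪ S1) R' (k + k1) k' rfl (hS.merge e2 hd'.1 hx e1 hxy)
      (hne.mono Finset.subset_union_left) e3
      (by rw [Finset.disjoint_union_left]; exact ⟨hd'.2, e4⟩)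
      (by rw [Finset.union_assoc, hu])
    rw [e6, ← add_assoc]
    exact this

theorem CC.tour [Fintype V] [Nonempty V] (hconn : ∀ X : Finset V, X.Nonempty →
    X ≠ Finset.univ → ∃ x ∈ X, ∃ y, y ∉ X ∧ G.Adj x y) {k : ℕ}
    (h : CC G Finset.univ k) : Tour G Finset.univ k := by
  obtain ⟨y⟩ := ‹Nonempty V›
  obtain ⟨S1, k1, R', k', e1, e2, e3, e4, e5, e6⟩ := h.extract (Finset.mem_univ y)
  rw [e6]
  exact CC.glue hconn _ S1 R' k1 k' rfl e2 ⟨y, e1⟩ e3 e4 e5.symm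

end covers

open Classical in
/-- Number of edges between `X` and `Y` (ordered pairs). -/
noncomputable def dd {V : Type*} (G : SimpleGraph V) (X Y : Finset V) : ℕ :=
  ∑ x ∈ X, ∑ y ∈ Y, if G.Adj x y then 1 else 0

/-- The potential `4 |S| - 2 e(S)`. -/
noncomputable def W {V : Type*} (G : SimpleGraph V) (S : Finset V) : ℤ :=
  4 * (S.card : ℤ) - (dd G S S : ℤ)

open Classical in
/-- `1` if `P` holds, `0` otherwise. -/
noncomputable def ind (P : Prop) : ℕ := if P then 1 else 0

open Classical in
/-- `G[S]` plus a virtual edge `ab` is 2-edge-connected with maximum degree at most 3. -/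
def Chain {V : Type*} (G : SimpleGraph V) (S : Finset V) (a b : V) : Prop :=
  a ∈ S ∧ b ∈ S ∧ (∀ v ∈ S, dd G {v} S + ind (v = a) + ind (v = b) ≤ 3) ∧
  ∀ X, X ⊆ S → X.Nonempty → X ≠ S → 2 ≤ dd G X (S \ X) + ind (¬ (a ∈ X ↔ b ∈ X))

open Classical in
/-- `G[S]` is 2-edge-connected (or a single vertex). -/
def Blk {V : Type*} (G : SimpleGraph V) (S : Finset V) : Prop :=
  ∀ X, X ⊆ S → X.Nonempty → X ≠ S → 2 ≤ dd G X (S \ X)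

section cuts
open Classical

variable {V : Type*} {G : SimpleGraph V}

theorem ind_true {P : Prop} (h : P) : ind P = 1 := by simp [ind, h]
theorem ind_false {P : Prop} (h : ¬ P) : ind P = 0 := by simp [ind, h]

theorem dd_comm (X Y : Finset V) : dd G X Y = dd G Y X := by
  unfold dd
  rw [Finset.sum_comm]
  simp only [G.adj_comm]

theorem dd_union_left {X X' : Finset V} (Y : Finset V) (h : Disjoint X X') :
    dd G (X ∪ X') Y = dd G X Y + dd G X' Y := by
  unfold dd
  rw [Finset.sum_union h]

theorem dd_union_right (Y : Finset V) {X X' : Finset V} (h : Disjoint X X') :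
    dd G Y (X ∪ X') = dd G Y X + dd G Y X' := by
  rw [dd_comm, dd_union_left _ h, dd_comm X, dd_comm X']

theorem dd_split (Y : Finset V) {X S : Finset V} (h : X ⊆ S) :
    dd G Y S = dd G Y X + dd G Y (S \ X) := by
  rw [← dd_union_right Y Finset.disjoint_sdiff, Finset.union_sdiff_of_subset h]

theorem dd_self (x : V) : dd G {x} {x} = 0 := by simp [dd]

theorem dd_sum (X Y : Finset V) : dd G X Y = ∑ x ∈ X, dd G {x} Y := by simp [dd]

theorem dd_pos {X Y : Finset V} (h : 0 < dd G X Y) : ∃ x ∈ X, ∃ y ∈ Y, G.Adj x y := by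
  by_contra hc
  push Not at hc
  have : dd G X Y = 0 := by
    unfold dd
    refine Finset.sum_eq_zero fun x hx => Finset.sum_eq_zero fun y hy => ?_
    simp [hc x hx y hy]
  omega

theorem dd_pos_of {X Y : Finset V} {x y : V} (hx : x ∈ X) (hy : y ∈ Y) (h : G.Adj x y) :
    0 < dd G X Y := by
  by_contra hc
  have h0 : dd G X Y = 0 := by omega
  unfold dd at h0
  rw [Finset.sum_eq_zero_iff] at h0
  have := h0 x hx
  rw [Finset.sum_eq_zero_iff] at this
  have := this y hy
  simp [h] at this

theorem dd_nbrs (u : V) (T : Finset V) : dd G {u} T = (T.filter (G.Adj u)).card := by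
  unfold dd
  rw [Finset.sum_singleton, Finset.card_filter]

theorem dd_single_single (u v : V) : dd G {u} {v} = ind (G.Adj u v) := by
  unfold dd ind
  rw [Finset.sum_singleton, Finset.sum_singleton]

theorem W_union {S T : Finset V} (h : Disjoint S T) :
    W G (S ∪ T) = W G S + W G T - 2 * (dd G S T : ℤ) := by
  unfold W
  rw [Finset.card_union_of_disjoint h, dd_union_left _ h, dd_union_right _ h,
    dd_union_right _ h, dd_comm T S]
  push_cast
  ring

theorem W_single (x : V) : W G {x} = 4 := by simp [W, dd_self]

theorem unique_aux {X Y : Finset V} (h : dd G X Y = 1) {s : V} (hs : s ∈ X)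
    (hp : 0 < dd G {s} Y) : ∀ Z, Z ⊆ X → dd G Z Y = ind (s ∈ Z) := by
  have hv : ∀ Z, Z ⊆ X → s ∉ Z → dd G Z Y = 0 := by
    intro Z hZ hsZ
    have hsub : {s} ⊆ X \ Z := by simp [hs, hsZ]
    have e1 := dd_split (G := G) Y hZ
    have e2 := dd_split (G := G) Y hsub
    rw [dd_comm] at h hp
    rw [dd_comm]
    omega
  intro Z hZ
  by_cases hsZ : s ∈ Z
  · rw [ind_true hsZ]
    have e1 := dd_split (G := G) Y hZ
    have e2 := hv (X \ Z) Finset.sdiff_subset (by simp [hsZ])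
    rw [dd_comm] at h e2
    rw [dd_comm]
    omega
  · rw [ind_false hsZ, hv Z hZ hsZ]

theorem unique_edge {X Y : Finset V} (h : dd G X Y = 1) : ∃ s ∈ X, ∃ t ∈ Y, G.Adj s t ∧
    (∀ Z, Z ⊆ X → dd G Z Y = ind (s ∈ Z)) ∧ (∀ Z, Z ⊆ Y → dd G Z X = ind (t ∈ Z)) := by
  obtain ⟨s, hs, t, ht, hst⟩ := dd_pos (G := G) (X := X) (Y := Y) (by omega)
  refine ⟨s, hs, t, ht, hst, unique_aux h hs (dd_pos_of (by simp) ht hst), ?_⟩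
  rw [dd_comm] at h
  exact unique_aux h ht (dd_pos_of (by simp) hs hst.symm)

theorem two_nbrs {u : V} {T : Finset V} (h : dd G {u} T = 2) : ∃ a ∈ T, ∃ b ∈ T, a ≠ b ∧
    G.Adj u a ∧ G.Adj u b ∧ ∀ Z, Z ⊆ T → dd G Z {u} = ind (a ∈ Z) + ind (b ∈ Z) := by
  rw [dd_nbrs, Finset.card_eq_two] at h
  obtain ⟨a, b, hab, h⟩ := h
  have ha : a ∈ T.filter (G.Adj u) := by rw [h]; simp
  have hb : b ∈ T.filter (G.Adj u) := by rw [h]; simp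
  rw [Finset.mem_filter] at ha hb
  refine ⟨a, ha.1, b, hb.1, hab, ha.2, hb.2, ?_⟩
  intro Z hZ
  rw [dd_comm, dd_nbrs]
  have : Z.filter (G.Adj u) = ({a, b} : Finset V).filter (· ∈ Z) := by
    rw [← h]
    ext z
    simp only [Finset.mem_filter]
    constructor
    · rintro ⟨h1, h2⟩; exact ⟨⟨hZ h1, h2⟩, h1⟩
    · rintro ⟨⟨_, h2⟩, h1⟩; exact ⟨h1, h2⟩
  rw [this, Finset.card_filter, Finset.sum_pair hab]
  unfold ind
  congr

theorem Chain.symm {S : Finset V} {a b : V} (h : Chain G S a b) : Chain G S b a := by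
  obtain ⟨h1, h2, h3, h4⟩ := h
  refine ⟨h2, h1, fun v hv => ?_, fun X hX hX1 hX2 => ?_⟩
  · have := h3 v hv; omega
  · have := h4 X hX hX1 hX2
    rwa [iff_comm] at this

theorem sdiff_ne {X S : Finset V} (h : X ⊆ S) (h1 : X.Nonempty) : S \ X ≠ S := by
  intro he
  obtain ⟨x, hx⟩ := h1
  have : x ∈ S \ X := by rw [he]; exact h hx
  simp [hx] at this

theorem sdiff_nonempty' {X S : Finset V} (h : X ⊆ S) (h2 : X ≠ S) : (S \ X).Nonempty := by
  rw [Finset.sdiff_nonempty]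
  intro h3
  exact h2 (Finset.Subset.antisymm h h3)

/-- One half of a chain split at a bridge. -/
theorem Chain.half {S X : Finset V} {a b s : V} (h : Chain G S a b) (hX : X ⊆ S)
    (ha : a ∈ X) (hb : b ∉ X) (hs : s ∈ X)
    (hu : ∀ Z, Z ⊆ X → dd G Z (S \ X) = ind (s ∈ Z)) : Chain G X a s := by
  obtain ⟨h1, h2, h3, h4⟩ := h
  refine ⟨ha, hs, fun v hv => ?_, ?_⟩
  · have e1 := h3 v (hX hv)
    have e2 := dd_split (G := G) {v} hX
    have e3 := hu {v} (by simpa using hv)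
    have e4 : ind (s ∈ ({v} : Finset V)) = ind (v = s) := by
      congr 1; simp [eq_comm]
    omega
  · have key : ∀ Y, Y ⊆ X → Y.Nonempty →
        2 ≤ dd G Y (X \ Y) + ind (s ∈ Y) + ind (a ∈ Y) := by
      intro Y hY hY1
      have hbY : b ∉ Y := fun hh => hb (hY hh)
      have hYS : Y ≠ S := fun hh => hbY (hh ▸ h2)
      have e1 := h4 Y (hY.trans hX) hY1 hYS
      have e2 := hu Y hY
      have e3 : dd G Y (S \ Y) = dd G Y (X \ Y) + dd G Y (S \ X) := by
        rw [← dd_union_right]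
        · congr 1
          ext z
          simp only [Finset.mem_sdiff, Finset.mem_union]
          constructor
          · rintro ⟨p, q⟩
            by_cases hz : z ∈ X
            · exact Or.inl ⟨hz, q⟩
            · exact Or.inr ⟨p, hz⟩
          · rintro (⟨p, q⟩ | ⟨p, q⟩)
            · exact ⟨hX p, q⟩
            · exact ⟨p, fun hh => q (hY hh)⟩
        · exact Finset.disjoint_left.2 fun z hz hz' =>
            (Finset.mem_sdiff.1 hz').2 (Finset.mem_sdiff.1 hz).1
      have e4 : ind (¬ (a ∈ Y ↔ b ∈ Y)) = ind (a ∈ Y) := by congr 1; simp [hbY]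
      omega
    intro Y hY hY1 hY2
    by_cases p1 : a ∈ Y <;> by_cases p2 : s ∈ Y
    · have := key (X \ Y) Finset.sdiff_subset (sdiff_nonempty' hY hY2)
      rw [Finset.sdiff_sdiff_eq_self hY, dd_comm, ind_false (by simp [p2]),
        ind_false (by simp [p1])] at this
      omega
    all_goals
      have := key Y hY hY1
      simp only [p1, p2, ind_true, ind_false, not_true_eq_false, not_false_eq_true, iff_true,
        iff_false, true_iff, false_iff] at this ⊢
      omega

/-- Split a chain at a bridge, or it is a block. -/
theorem Chain.split {S : Finset V} {a b : V} (h : Chain G S a b) : Blk G S ∨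
    ∃ S₁ S₂ s t, Disjoint S₁ S₂ ∧ S₁ ∪ S₂ = S ∧ S₁.card < S.card ∧ S₂.card < S.card ∧
      G.Adj s t ∧ Chain G S₁ a s ∧ Chain G S₂ t b ∧
      (∀ v ∈ S₁, dd G {v} S = dd G {v} S₁ + ind (v = s) ∧ v ≠ b) ∧
      (∀ v ∈ S₂, dd G {v} S = dd G {v} S₂ + ind (v = t) ∧ v ≠ a) ∧
      W G S = W G S₁ + W G S₂ - 2 := by
  by_cases hB : Blk G S
  · exact Or.inl hB
  right
  unfold Blk at hB
  push Not at hB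
  have hB' : ∃ X, X ⊆ S ∧ a ∈ X ∧ b ∉ X ∧ dd G X (S \ X) = 1 := by
    obtain ⟨X, hX, hX1, hX2, hX3⟩ := hB
    have e1 := h.2.2.2 X hX hX1 hX2
    by_cases p1 : a ∈ X <;> by_cases p2 : b ∈ X
    · simp [p1, p2, ind] at e1; omega
    · refine ⟨X, hX, p1, p2, ?_⟩
      simp [p1, p2, ind] at e1; omega
    · refine ⟨S \ X, Finset.sdiff_subset, by simp [p1, h.1], by simp [p2], ?_⟩
      rw [Finset.sdiff_sdiff_eq_self hX, dd_comm]
      simp [p1, p2, ind] at e1; omega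
    · simp [p1, p2, ind] at e1; omega
  obtain ⟨X, hX, ha, hb, h1⟩ := hB'
  obtain ⟨s, hs, t, ht, hst, u1, u2⟩ := unique_edge h1
  have hU : X ∪ S \ X = S := Finset.union_sdiff_of_subset hX
  have hD : Disjoint X (S \ X) := Finset.disjoint_sdiff
  have hc := Finset.card_union_of_disjoint hD
  rw [hU] at hc
  have c1 : 0 < X.card := Finset.card_pos.2 ⟨a, ha⟩
  have c2 : 0 < (S \ X).card := Finset.card_pos.2 ⟨t, ht⟩
  have hXX : S \ (S \ X) = X := Finset.sdiff_sdiff_eq_self hX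
  refine ⟨X, S \ X, s, t, hD, hU, by omega, by omega, hst, h.half hX ha hb hs u1, ?_, ?_, ?_, ?_⟩
  · refine (h.symm.half Finset.sdiff_subset ?_ ?_ ht ?_).symm
    · simp [h.2.1, hb]
    · simp [ha]
    · rw [hXX]; exact u2
  · intro v hv
    refine ⟨?_, fun hh => hb (hh ▸ hv)⟩
    rw [dd_split {v} hX, u1 {v} (by simpa using hv)]
    congr 2; simp [eq_comm]
  · intro v hv
    refine ⟨?_, fun hh => (Finset.mem_sdiff.1 hv).2 (hh ▸ ha)⟩
    rw [dd_split {v} (Finset.sdiff_subset : S \ X ⊆ S), hXX, u2 {v} (by simpa using hv)]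
    congr 2; simp [eq_comm]
  · have := W_union (G := G) hD
    rw [hU, h1] at this
    rw [this]; push_cast; ring

theorem Blk.deg {S : Finset V} (h : Blk G S) {u : V} (hu : u ∈ S) (hne : S ≠ {u}) :
    2 ≤ dd G {u} S := by
  have e1 := h {u} (by simpa using hu) (by simp) hne.symm
  have e2 := dd_split (G := G) {u} (show {u} ⊆ S by simpa using hu)
  omega

/-- Removing a degree-2 vertex of a block leaves a chain. -/
theorem Blk.remove {S : Finset V} (h : Blk G S) (hdeg : ∀ v ∈ S, dd G {v} S ≤ 3) {u : V}
    (hu : u ∈ S) (hne : S ≠ {u}) (h2 : dd G {u} S ≤ 2) :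
    ∃ a b, a ≠ b ∧ G.Adj u a ∧ G.Adj u b ∧ Chain G (S \ {u}) a b ∧
      (∀ v ∈ S \ {u}, dd G {v} S = dd G {v} (S \ {u}) + ind (v = a) + ind (v = b)) ∧
      W G S = W G (S \ {u}) ∧ (S \ {u}).card < S.card := by
  have huS : {u} ⊆ S := by simpa using hu
  have e0 := h.deg hu hne
  have e1 := dd_split (G := G) {u} huS
  rw [dd_self] at e1
  have e2 : dd G {u} (S \ {u}) = 2 := by omega
  obtain ⟨a, ha, b, hb, hab, hua, hub, hZ⟩ := two_nbrs e2
  have hd : ∀ v ∈ S \ {u}, dd G {v} S = dd G {v} (S \ {u}) + ind (v = a) + ind (v = b) := by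
    intro v hv
    rw [dd_split {v} huS, hZ {v} (by simpa using hv)]
    simp only [Finset.mem_singleton, eq_comm (a := a), eq_comm (a := b)]
    omega
  refine ⟨a, b, hab, hua, hub, ⟨ha, hb, ?_, ?_⟩, hd, ?_, ?_⟩
  · intro v hv
    have := hdeg v (Finset.mem_sdiff.1 hv).1
    have := hd v hv
    omega
  · have key : ∀ Y, Y ⊆ S \ {u} → Y.Nonempty →
        2 ≤ dd G Y ((S \ {u}) \ Y) + ind (a ∈ Y) + ind (b ∈ Y) := by
      intro Y hY hY1
      have huY : u ∉ Y := fun hh => by simpa using hY hh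
      have f1 := h Y (hY.trans Finset.sdiff_subset) hY1 (fun hh => huY (hh ▸ hu))
      have f2 := dd_split (G := G) Y (show {u} ⊆ S \ Y by simp [hu, huY])
      have f3 : (S \ Y) \ {u} = (S \ {u}) \ Y := by
        ext z; simp only [Finset.mem_sdiff]; tauto
      rw [f3, hZ Y hY] at f2
      omega
    intro Y hY hY1 hY2
    by_cases p1 : a ∈ Y <;> by_cases p2 : b ∈ Y
    · have := key ((S \ {u}) \ Y) Finset.sdiff_subset (sdiff_nonempty' hY hY2)
      rw [Finset.sdiff_sdiff_eq_self hY, dd_comm, ind_false (by simp [p1]),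
        ind_false (by simp [p2])] at this
      omega
    all_goals
      have := key Y hY hY1
      simp only [p1, p2, ind_true, ind_false, not_true_eq_false, not_false_eq_true, iff_true,
        iff_false, true_iff, false_iff] at this ⊢
      omega
  · have hD : Disjoint {u} (S \ {u}) := Finset.disjoint_sdiff
    have := W_union (G := G) hD
    rw [Finset.union_sdiff_of_subset huS, W_single, e2] at this
    rw [this]; push_cast; ring
  · exact Finset.card_lt_card ⟨Finset.sdiff_subset, fun hh => by simpa using hh hu⟩

end cuts

open Classical in
/-- `z` has spare degree in the chain `S` with ends `a`, `b`. -/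
def OKv {V : Type*} (G : SimpleGraph V) (S : Finset V) (a b z : V) : Prop :=
  z ∈ S ∧ dd G {z} S + ind (z = a) + ind (z = b) ≤ 2

/-- Claim I. -/
def CI {V : Type*} (G : SimpleGraph V) (S : Finset V) : Prop :=
  ∀ a b, Chain G S a b → ∃ p c : ℕ, PC G S a b p ∧ CC G S c ∧
    4 * (p : ℤ) + 4 ≤ W G S ∧ 2 * ((p : ℤ) + c) + 2 ≤ W G S

/-- Claim II. -/
def CII {V : Type*} (G : SimpleGraph V) (S : Finset V) : Prop :=
  ∀ x y z, Blk G S → (∀ v ∈ S, dd G {v} S ≤ 3) → x ∈ S → y ∈ S → z ∈ S →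
    x ≠ y → x ≠ z → y ≠ z → dd G {x} S ≤ 2 → dd G {y} S ≤ 2 → dd G {z} S ≤ 2 →
    ∃ p q : ℕ, PC G S x y p ∧ PC G S x z q ∧ 2 * ((p : ℤ) + q) + 6 ≤ W G S

/-- Claim III. -/
def CIII {V : Type*} (G : SimpleGraph V) (S : Finset V) : Prop :=
  ∀ a b z, Chain G S a b → OKv G S a b z →
    ∃ p q : ℕ, PC G S a b p ∧ PC G S a z q ∧ 2 * ((p : ℤ) + q) + 4 ≤ W G S

/-- Claim V. -/
def CV {V : Type*} (G : SimpleGraph V) (S : Finset V) : Prop :=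
  ∀ a b z, Chain G S a b → OKv G S a b z →
    ∃ p q : ℕ, PC G S a z p ∧ PC G S b z q ∧ 2 * ((p : ℤ) + q) + 4 ≤ W G S

/-- Claim IV. -/
def CIV {V : Type*} (G : SimpleGraph V) (S : Finset V) : Prop :=
  ∀ a b y z, Chain G S a b → OKv G S a b y → OKv G S a b z → y ≠ z →
    (∃ p q : ℕ, PC G S b y p ∧ PC G S a z q ∧ 2 * ((p : ℤ) + q) + 6 ≤ W G S) ∨
    (∃ p q : ℕ, PC G S a y p ∧ PC G S b z q ∧ 2 * ((p : ℤ) + q) + 6 ≤ W G S) ∨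
    (∃ p q r s : ℕ, PC G S a y p ∧ PC G S a z q ∧ PC G S b y r ∧ PC G S b z s ∧
      (p : ℤ) + q + r + s + 6 ≤ W G S)

section main
open Classical

variable {V : Type*} {G : SimpleGraph V}

theorem PC.glue {S₁ S₂ S : Finset V} {x s t y : V} {k l : ℕ} (h₁ : PC G S₁ x s k)
    (hst : G.Adj s t) (h₂ : PC G S₂ t y l) (hD : Disjoint S₁ S₂) (hU : S₁ ∪ S₂ = S) :
    PC G S x y (k + l) := hU ▸ PC.concat h₁ hst h₂ hD

theorem PC.add1 {S₁ S₂ S : Finset V} {x y : V} {k l : ℕ} (h₁ : PC G S₁ x y k)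
    (h₂ : CC G S₂ l) (hD : Disjoint S₁ S₂) (hU : S₁ ∪ S₂ = S) :
    PC G S x y (k + l) := hU ▸ PC.add h₁ h₂ hD

theorem PC.add2 {S₁ S₂ S : Finset V} {x y : V} {k l : ℕ} (h₁ : CC G S₁ k)
    (h₂ : PC G S₂ x y l) (hD : Disjoint S₁ S₂) (hU : S₁ ∪ S₂ = S) :
    PC G S x y (l + k) := by
  subst hU
  rw [Finset.union_comm]
  exact PC.add h₂ h₁ hD.symm

theorem OKv.symm {S : Finset V} {a b z : V} (h : OKv G S a b z) : OKv G S b a z :=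
  ⟨h.1, by have := h.2; omega⟩

theorem Chain.deg {S : Finset V} {a b : V} (h : Chain G S a b) : ∀ v ∈ S, dd G {v} S ≤ 3 := by
  intro v hv
  have := h.2.2.1 v hv
  omega

/-- The block case of a chain. -/
theorem Chain.blk {S : Finset V} {a b : V} (h : Chain G S a b) (hB : Blk G S) :
    (S = {a} ∧ b = a) ∨ (S ≠ {a} ∧ a ≠ b ∧ dd G {a} S ≤ 2 ∧ dd G {b} S ≤ 2 ∧
      ∀ z, OKv G S a b z → z ≠ a ∧ z ≠ b ∧ dd G {z} S ≤ 2) := by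
  have hS := h
  obtain ⟨h1, h2, h3, h4⟩ := h
  by_cases hSa : S = {a}
  · left
    refine ⟨hSa, ?_⟩
    rw [hSa] at h2
    simpa using h2
  right
  have hne : ∀ u, S ≠ {u} := by
    intro u hu
    rw [hu] at h1
    have : a = u := by simpa using h1
    exact hSa (this ▸ hu)
  have e1 := hB.deg h1 (hne a)
  have e2 := hB.deg h2 (hne b)
  have f1 := h3 a h1
  have f2 := h3 b h2
  rw [ind_true rfl] at f1
  rw [ind_true (P := b = b) rfl] at f2
  refine ⟨hSa, ?_, by omega, by omega, ?_⟩
  · rintro rfl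
    rw [ind_true rfl] at f1
    omega
  · rintro z ⟨hz, hz2⟩
    have e3 := hB.deg hz (hne z)
    refine ⟨?_, ?_, by omega⟩
    · rintro rfl
      rw [ind_true rfl] at hz2; omega
    · rintro rfl
      rw [ind_true (P := z = z) rfl] at hz2; omega

theorem step_II {S : Finset V} (ih : ∀ T : Finset V, T.card < S.card → CIV G T) : CII G S := by
  intro x y z hB hdeg hx hy hz hxy hxz hyz dx dy dz
  have hne : S ≠ {x} := by
    intro hh
    rw [hh] at hy
    exact hxy (by simpa using hy : y = x).symm
  obtain ⟨a, b, hab, hxa, hxb, hC, hd, hW, hcard⟩ := hB.remove hdeg hx hne dx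
  have hy' : y ∈ S \ {x} := by simp [hy, hxy.symm]
  have hz' : z ∈ S \ {x} := by simp [hz, hxz.symm]
  have oy : OKv G (S \ {x}) a b y := ⟨hy', by have := hd y hy'; omega⟩
  have oz : OKv G (S \ {x}) a b z := ⟨hz', by have := hd z hz'; omega⟩
  have hD : Disjoint {x} (S \ {x}) := Finset.disjoint_sdiff
  have hU : {x} ∪ (S \ {x}) = S := Finset.union_sdiff_of_subset (by simpa using hx)
  rw [hW]
  rcases ih _ hcard a b y z hC oy oz hyz with ⟨p, q, h1, h2, h3⟩ | ⟨p, q, h1, h2, h3⟩ |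
    ⟨p, q, r, s, h1, h2, h3, h4, h5⟩
  · exact ⟨_, _, (PC.single x).glue hxb h1 hD hU, (PC.single x).glue hxa h2 hD hU, by
      push_cast; omega⟩
  · exact ⟨_, _, (PC.single x).glue hxa h1 hD hU, (PC.single x).glue hxb h2 hD hU, by
      push_cast; omega⟩
  · by_cases hc : p + q ≤ r + s
    · exact ⟨_, _, (PC.single x).glue hxa h1 hD hU, (PC.single x).glue hxa h2 hD hU, by
        push_cast; omega⟩
    · exact ⟨_, _, (PC.single x).glue hxb h3 hD hU, (PC.single x).glue hxb h4 hD hU, by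
        push_cast; omega⟩

theorem step_III {S : Finset V} (ihI : ∀ T : Finset V, T.card < S.card → CI G T)
    (ih : ∀ T : Finset V, T.card < S.card → CIII G T) (h2 : CII G S) : CIII G S := by
  intro a b z hC hz
  rcases hC.split with hB | ⟨S₁, S₂, s, t, hD, hU, c1, c2, hst, C1, C2, d1, d2, hW⟩
  · rcases hC.blk hB with ⟨hS, rfl⟩ | ⟨hS, hab, da, db, hz'⟩
    · have hzb : z = b := by have := hz.1; rw [hS] at this; simpa using this
      subst hzb
      rw [hS]
      exact ⟨0, 0, PC.single z, PC.single z, by rw [W_single]; norm_num⟩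
    · obtain ⟨z1, z2, z3⟩ := hz' z hz
      obtain ⟨p, q, h1, h2, h3⟩ := h2 a b z hB hC.deg hC.1 hC.2.1 hz.1 hab z1.symm z2.symm da db z3
      exact ⟨p, q, h1, h2, by omega⟩
  · have hz1 := hz.1
    have hz2 := hz.2
    rw [← hU, Finset.mem_union] at hz1
    rcases hz1 with hz1 | hz1
    · obtain ⟨e1, e2⟩ := d1 z hz1
      rw [ind_false e2] at hz2
      obtain ⟨p1, q1, A1, A2, A3⟩ := ih S₁ c1 a s z C1 ⟨hz1, by omega⟩
      obtain ⟨p2, k2, B1, B2, B3, B4⟩ := ihI S₂ c2 t b C2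
      exact ⟨_, _, A1.glue hst B1 hD hU, A2.add1 B2 hD hU, by push_cast; omega⟩
    · obtain ⟨e1, e2⟩ := d2 z hz1
      rw [ind_false e2] at hz2
      obtain ⟨p2, q2, A1, A2, A3⟩ := ih S₂ c2 t b z C2 ⟨hz1, by omega⟩
      obtain ⟨p1, k1, B1, B2, B3, B4⟩ := ihI S₁ c1 a s C1
      exact ⟨_, _, B1.glue hst A1 hD hU, B1.glue hst A2 hD hU, by push_cast; omega⟩

theorem step_V {S : Finset V} (ihI : ∀ T : Finset V, T.card < S.card → CI G T)
    (ih : ∀ T : Finset V, T.card < S.card → CV G T) (h2 : CII G S) : CV G S := by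
  intro a b z hC hz
  rcases hC.split with hB | ⟨S₁, S₂, s, t, hD, hU, c1, c2, hst, C1, C2, d1, d2, hW⟩
  · rcases hC.blk hB with ⟨hS, rfl⟩ | ⟨hS, hab, da, db, hz'⟩
    · have hzb : z = b := by have := hz.1; rw [hS] at this; simpa using this
      subst hzb
      rw [hS]
      exact ⟨0, 0, PC.single z, PC.single z, by rw [W_single]; norm_num⟩
    · obtain ⟨z1, z2, z3⟩ := hz' z hz
      obtain ⟨p, q, h1, h2, h3⟩ := h2 z a b hB hC.deg hz.1 hC.1 hC.2.1 z1 z2 hab z3 da db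
      exact ⟨p, q, h1.symm, h2.symm, by omega⟩
  · have hz1 := hz.1
    have hz2 := hz.2
    rw [← hU, Finset.mem_union] at hz1
    rcases hz1 with hz1 | hz1
    · obtain ⟨e1, e2⟩ := d1 z hz1
      rw [ind_false e2] at hz2
      obtain ⟨p1, q1, A1, A2, A3⟩ := ih S₁ c1 a s z C1 ⟨hz1, by omega⟩
      obtain ⟨p2, k2, B1, B2, B3, B4⟩ := ihI S₂ c2 t b C2
      exact ⟨_, _, A1.add1 B2 hD hU, (A2.symm.glue hst B1 hD hU).symm, by push_cast; omega⟩
    · obtain ⟨e1, e2⟩ := d2 z hz1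
      rw [ind_false e2] at hz2
      obtain ⟨p2, q2, A1, A2, A3⟩ := ih S₂ c2 t b z C2 ⟨hz1, by omega⟩
      obtain ⟨p1, k1, B1, B2, B3, B4⟩ := ihI S₁ c1 a s C1
      exact ⟨_, _, B1.glue hst A1 hD hU, PC.add2 B2 A2 hD hU, by push_cast; omega⟩

theorem step_IV {S : Finset V} (ihI : ∀ T : Finset V, T.card < S.card → CI G T)
    (ih3 : ∀ T : Finset V, T.card < S.card → CIII G T)
    (ih : ∀ T : Finset V, T.card < S.card → CIV G T) (h2 : CII G S) : CIV G S := by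
  intro a b y z hC hy hz hyz
  rcases hC.split with hB | ⟨S₁, S₂, s, t, hD, hU, c1, c2, hst, C1, C2, d1, d2, hW⟩
  · rcases hC.blk hB with ⟨hS, rfl⟩ | ⟨hS, hab, da, db, hz'⟩
    · have hzb : z = b := by have := hz.1; rw [hS] at this; simpa using this
      have hyb : y = b := by have := hy.1; rw [hS] at this; simpa using this
      exact absurd (hyb.trans hzb.symm) hyz
    · obtain ⟨z1, z2, z3⟩ := hz' z hz
      obtain ⟨y1, y2, y3⟩ := hz' y hy
      obtain ⟨p, q, A1, A2, A3⟩ := h2 a y z hB hC.deg hC.1 hy.1 hz.1 y1.symm z1.symm hyz da y3 z3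
      obtain ⟨r, s, B1, B2, B3⟩ := h2 b y z hB hC.deg hC.2.1 hy.1 hz.1 y2.symm z2.symm hyz db y3 z3
      exact Or.inr (Or.inr ⟨p, q, r, s, A1, A2, B1, B2, by omega⟩)
  · have hz1 := hz.1
    have hz2 := hz.2
    have hy1 := hy.1
    have hy2 := hy.2
    rw [← hU, Finset.mem_union] at hz1 hy1
    obtain ⟨p1, k1, I1, I2, I3, I4⟩ := ihI S₁ c1 a s C1
    obtain ⟨p2, k2, J1, J2, J3, J4⟩ := ihI S₂ c2 t b C2
    rcases hy1 with hy1 | hy1 <;> rcases hz1 with hz1 | hz1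
    · obtain ⟨e1, e2⟩ := d1 z hz1
      rw [ind_false e2] at hz2
      obtain ⟨f1, f2⟩ := d1 y hy1
      rw [ind_false f2] at hy2
      rcases ih S₁ c1 a s y z C1 ⟨hy1, by omega⟩ ⟨hz1, by omega⟩ hyz with
        ⟨p, q, h1, h2, h3⟩ | ⟨p, q, h1, h2, h3⟩ | ⟨p, q, r, s, h1, h2, h3, h4, h5⟩
      · exact Or.inl ⟨_, _, (h1.symm.glue hst J1 hD hU).symm, h2.add1 J2 hD hU, by
          push_cast; omega⟩
      · exact Or.inr (Or.inl ⟨_, _, h1.add1 J2 hD hU, (h2.symm.glue hst J1 hD hU).symm, by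
          push_cast; omega⟩)
      · exact Or.inr (Or.inr ⟨_, _, _, _, h1.add1 J2 hD hU, h2.add1 J2 hD hU,
          (h3.symm.glue hst J1 hD hU).symm, (h4.symm.glue hst J1 hD hU).symm, by
          push_cast; omega⟩)
    · obtain ⟨e1, e2⟩ := d2 z hz1
      rw [ind_false e2] at hz2
      obtain ⟨f1, f2⟩ := d1 y hy1
      rw [ind_false f2] at hy2
      obtain ⟨q1, r1, A1, A2, A3⟩ := ih3 S₁ c1 s a y C1.symm ⟨hy1, by omega⟩
      obtain ⟨q2, r2, B1, B2, B3⟩ := ih3 S₂ c2 t b z C2 ⟨hz1, by omega⟩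
      exact Or.inl ⟨_, _, (A2.symm.glue hst B1 hD hU).symm, A1.symm.glue hst B2 hD hU, by
        push_cast; omega⟩
    · obtain ⟨e1, e2⟩ := d1 z hz1
      rw [ind_false e2] at hz2
      obtain ⟨f1, f2⟩ := d2 y hy1
      rw [ind_false f2] at hy2
      obtain ⟨q1, r1, A1, A2, A3⟩ := ih3 S₁ c1 s a z C1.symm ⟨hz1, by omega⟩
      obtain ⟨q2, r2, B1, B2, B3⟩ := ih3 S₂ c2 t b y C2 ⟨hy1, by omega⟩
      exact Or.inr (Or.inl ⟨_, _, A1.symm.glue hst B2 hD hU, (A2.symm.glue hst B1 hD hU).symm, by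
        push_cast; omega⟩)
    · obtain ⟨e1, e2⟩ := d2 z hz1
      rw [ind_false e2] at hz2
      obtain ⟨f1, f2⟩ := d2 y hy1
      rw [ind_false f2] at hy2
      rcases ih S₂ c2 t b y z C2 ⟨hy1, by omega⟩ ⟨hz1, by omega⟩ hyz with
        ⟨p, q, h1, h2, h3⟩ | ⟨p, q, h1, h2, h3⟩ | ⟨p, q, r, s, h1, h2, h3, h4, h5⟩
      · exact Or.inl ⟨_, _, PC.add2 I2 h1 hD hU, I1.glue hst h2 hD hU, by
          push_cast; omega⟩
      · exact Or.inr (Or.inl ⟨_, _, I1.glue hst h1 hD hU, PC.add2 I2 h2 hD hU, by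
          push_cast; omega⟩)
      · exact Or.inr (Or.inr ⟨_, _, _, _, I1.glue hst h1 hD hU, I1.glue hst h2 hD hU,
          PC.add2 I2 h3 hD hU, PC.add2 I2 h4 hD hU, by push_cast; omega⟩)

/-- Strengthening of claim III when one may choose the end. -/
theorem three_prime {S : Finset V} (ihI : ∀ T : Finset V, T.card < S.card → CI G T)
    (ih3 : ∀ T : Finset V, T.card < S.card → CIII G T) (h2 : CII G S) {a b v : V}
    (hC : Chain G S a b) (hab : a ≠ b) (hv : OKv G S a b v) :
    ∃ p q : ℕ, PC G S a b p ∧ (PC G S a v q ∨ PC G S b v q) ∧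
      2 * ((p : ℤ) + q) + 6 ≤ W G S := by
  rcases hC.split with hB | ⟨S₁, S₂, s, t, hD, hU, c1, c2, hst, C1, C2, d1, d2, hW⟩
  · rcases hC.blk hB with ⟨hS, rfl⟩ | ⟨hS, hab, da, db, hz'⟩
    · exact absurd rfl hab
    · obtain ⟨z1, z2, z3⟩ := hz' v hv
      obtain ⟨p, q, h1, h2, h3⟩ := h2 a b v hB hC.deg hC.1 hC.2.1 hv.1 hab z1.symm z2.symm da db z3
      exact ⟨p, q, h1, Or.inl h2, by omega⟩
  · have hz1 := hv.1
    have hz2 := hv.2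
    rw [← hU, Finset.mem_union] at hz1
    rcases hz1 with hz1 | hz1
    · obtain ⟨e1, e2⟩ := d1 v hz1
      rw [ind_false e2] at hz2
      obtain ⟨p1, q1, A1, A2, A3⟩ := ih3 S₁ c1 s a v C1.symm ⟨hz1, by omega⟩
      obtain ⟨p2, k2, B1, B2, B3, B4⟩ := ihI S₂ c2 t b C2
      exact ⟨_, _, A1.symm.glue hst B1 hD hU, Or.inr (A2.symm.glue hst B1 hD hU).symm, by
        push_cast; omega⟩
    · obtain ⟨e1, e2⟩ := d2 v hz1
      rw [ind_false e2] at hz2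
      obtain ⟨p2, q2, A1, A2, A3⟩ := ih3 S₂ c2 t b v C2 ⟨hz1, by omega⟩
      obtain ⟨p1, k1, B1, B2, B3, B4⟩ := ihI S₁ c1 a s C1
      exact ⟨_, _, B1.glue hst A1 hD hU, Or.inl (B1.glue hst A2 hD hU), by push_cast; omega⟩

theorem step_I {S : Finset V} (ih : ∀ T : Finset V, T.card < S.card →
    CI G T ∧ CII G T ∧ CIII G T ∧ CV G T) : CI G S := by
  intro a b hC
  rcases hC.split with hB | ⟨S₁, S₂, s, t, hD, hU, c1, c2, hst, C1, C2, d1, d2, hW⟩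
  · rcases hC.blk hB with ⟨hS, rfl⟩ | ⟨hS, hab, da, db, hz'⟩
    · rw [hS]
      exact ⟨0, 1, PC.single b, CC.single b, by rw [W_single]; norm_num, by
        rw [W_single]; norm_num⟩
    · obtain ⟨a', b', hab', ha, hb, hC', hd, hW, hcard⟩ := hB.remove hC.deg hC.1 hS da
      have hb' : b ∈ S \ {a} := by simp [hC.2.1, hab.symm]
      have ob : OKv G (S \ {a}) a' b' b := ⟨hb', by have := hd b hb'; omega⟩
      have hD : Disjoint {a} (S \ {a}) := Finset.disjoint_sdiff
      have hU : {a} ∪ (S \ {a}) = S := Finset.union_sdiff_of_subset (by simpa using hC.1)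
      obtain ⟨p, q, A1, A2, A3⟩ := three_prime (fun T hT => (ih T (hT.trans hcard)).1)
        (fun T hT => (ih T (hT.trans hcard)).2.2.1) (ih _ hcard).2.1 hC' hab' ob
      obtain ⟨r, s, B1, B2, B3⟩ := (ih _ hcard).2.2.2 a' b' b hC' ob
      have hm : ∃ m : ℕ, PC G S a b m ∧ 4 * (m : ℤ) + 4 ≤ W G S := by
        by_cases hrs : r ≤ s
        · exact ⟨_, (PC.single a).glue ha B1 hD hU, by push_cast; omega⟩
        · exact ⟨_, (PC.single a).glue hb B2 hD hU, by push_cast; omega⟩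
      have hq : PC G S a b (0 + q) := by
        rcases A2 with A2 | A2
        · exact (PC.single a).glue ha A2 hD hU
        · exact (PC.single a).glue hb A2 hD hU
      have hc : CC G S (0 + p + 2) := ((PC.single a).glue ha A1 hD hU).close hb
      obtain ⟨m, hm1, hm2⟩ := hm
      by_cases hmq : m ≤ 0 + q
      · exact ⟨m, _, hm1, hc, hm2, by push_cast; omega⟩
      · exact ⟨0 + q, _, hq, hc, by push_cast; omega, by push_cast; omega⟩
  · obtain ⟨p1, k1, I1, I2, I3, I4⟩ := (ih S₁ c1).1 a s C1
    obtain ⟨p2, k2, J1, J2, J3, J4⟩ := (ih S₂ c2).1 t b C2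
    exact ⟨_, _, I1.glue hst J1 hD hU, hU ▸ I2.union J2 hD, by push_cast; omega, by
      push_cast; omega⟩

theorem all_claims (n : ℕ) : ∀ S : Finset V, S.card = n →
    CI G S ∧ CII G S ∧ CIII G S ∧ CV G S ∧ CIV G S := by
  induction n using Nat.strong_induction_on with
  | _ n ih =>
    intro S hS
    have ih' : ∀ T : Finset V, T.card < S.card →
        CI G T ∧ CII G T ∧ CIII G T ∧ CV G T ∧ CIV G T :=
      fun T hT => ih T.card (hS ▸ hT) T rfl
    have i1 := fun T hT => (ih' T hT).1
    have i3 := fun T hT => (ih' T hT).2.2.1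
    have i5 := fun T hT => (ih' T hT).2.2.2.1
    have i4 := fun T hT => (ih' T hT).2.2.2.2
    have h2 := step_II i4
    exact ⟨step_I fun T hT => ⟨(ih' T hT).1, (ih' T hT).2.1, (ih' T hT).2.2.1,
      (ih' T hT).2.2.2.1⟩, h2, step_III i1 i3 h2, step_V i1 i5 h2, step_IV i1 i3 i4 h2⟩

/-- The main path-cover bound for chains. -/
theorem Chain.path {S : Finset V} {a b : V} (h : Chain G S a b) :
    ∃ p : ℕ, PC G S a b p ∧ 4 * (p : ℤ) + 4 ≤ W G S := by
  obtain ⟨p, c, h1, _, h3, _⟩ := (all_claims S.card S rfl).1 a b h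
  exact ⟨p, h1, h3⟩

end main

open Classical in
/-- `e` is the only edge across some cut of `G[S]`. -/
def CB {V : Type*} (G : SimpleGraph V) (S : Finset V) (e : Sym2 V) : Prop :=
  ∃ X, X ⊆ S ∧ ∃ x ∈ X, ∃ y ∈ S \ X, e = s(x, y) ∧ G.Adj x y ∧ dd G X (S \ X) = 1

section top
open Classical

variable {V : Type*} {G : SimpleGraph V}

theorem dd_mono {X X' Y Y' : Finset V} (hX : X ⊆ X') (hY : Y ⊆ Y') :
    dd G X Y ≤ dd G X' Y' := by
  have e1 := dd_split (G := G) X hY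
  have e2 := dd_split (G := G) Y' hX
  rw [dd_comm, dd_comm Y' X] at e2
  omega

theorem dd_delete {x d : V} (h : G.Adj x d) (X Y : Finset V) :
    dd G X Y = dd (G.deleteEdges {s(x, d)}) X Y + ind (x ∈ X ∧ d ∈ Y) + ind (d ∈ X ∧ x ∈ Y) := by
  have hne := h.ne
  have key : ∀ u v : V, (if G.Adj u v then 1 else 0 : ℕ) =
      (if (G.deleteEdges {s(x, d)}).Adj u v then 1 else 0) +
      (if u = x then if v = d then 1 else 0 else 0) +
      (if u = d then if v = x then 1 else 0 else 0) := by
    intro u v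
    by_cases h1 : u = x ∧ v = d
    · obtain ⟨rfl, rfl⟩ := h1
      simp [h, hne, hne.symm]
    by_cases h2 : u = d ∧ v = x
    · obtain ⟨rfl, rfl⟩ := h2
      simp [h.symm, hne, hne.symm, Sym2.eq_swap]
    have h3 : (G.deleteEdges {s(x, d)}).Adj u v ↔ G.Adj u v := by
      rw [deleteEdges_adj]
      simp only [Set.mem_singleton_iff, Sym2.eq_iff]
      tauto
    have h4 : (if u = x then if v = d then 1 else 0 else 0 : ℕ) = 0 := by
      split_ifs with p q
      · exact absurd ⟨p, q⟩ h1
      all_goals rfl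
    have h5 : (if u = d then if v = x then 1 else 0 else 0 : ℕ) = 0 := by
      split_ifs with p q
      · exact absurd ⟨p, q⟩ h2
      all_goals rfl
    rw [h4, h5]
    simp only [h3, add_zero]
  have aux : ∀ a b : V, (∑ u ∈ X, ∑ v ∈ Y, (if u = a then if v = b then 1 else 0 else 0 : ℕ)) =
      ind (a ∈ X ∧ b ∈ Y) := by
    intro a b
    have : ∀ u : V, (∑ v ∈ Y, (if u = a then if v = b then 1 else 0 else 0 : ℕ)) =
        if u = a then (if b ∈ Y then 1 else 0) else 0 := by
      intro u
      by_cases hu : u = a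
      · simp [hu]
      · simp [hu]
    rw [Finset.sum_congr rfl fun u _ => this u, Finset.sum_ite_eq']
    unfold ind
    by_cases p : a ∈ X <;> by_cases q : b ∈ Y <;> simp [p, q]
  rw [← aux x d, ← aux d x]
  unfold dd
  rw [← Finset.sum_add_distrib, ← Finset.sum_add_distrib]
  refine Finset.sum_congr rfl fun u _ => ?_
  rw [← Finset.sum_add_distrib, ← Finset.sum_add_distrib]
  exact Finset.sum_congr rfl fun v _ => by convert key u v

/-- Crossing edges seen from a piece. -/
theorem dd_piece {S S₁ X : Finset V} {s : V} (h1 : S₁ ⊆ S)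
    (hu : ∀ Z, Z ⊆ S₁ → dd G Z (S \ S₁) = ind (s ∈ Z)) (hX : X ⊆ S₁) (hs : s ∉ X) :
    dd G X (S \ X) = dd G X (S₁ \ X) := by
  have e1 := hu X hX
  rw [ind_false hs] at e1
  have e2 := dd_split (G := G) X (show S₁ \ X ⊆ S \ X from Finset.sdiff_subset_sdiff h1 le_rfl)
  have e3 : (S \ X) \ (S₁ \ X) = S \ S₁ := by
    ext z
    have := @hX z
    simp only [Finset.mem_sdiff]
    tauto
  rw [e3] at e2
  omega

theorem CB.swap {S : Finset V} {e : Sym2 V} (h : CB G S e) (s : V) :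
    ∃ X, X ⊆ S ∧ s ∉ X ∧ ∃ x ∈ X, ∃ y ∈ S \ X, e = s(x, y) ∧ G.Adj x y ∧
      dd G X (S \ X) = 1 := by
  obtain ⟨X, hX, x, hx, y, hy, he, ha, hd⟩ := h
  by_cases hs : s ∈ X
  · refine ⟨S \ X, Finset.sdiff_subset, by simp [hs], y, hy, x, ?_, ?_, ha.symm, ?_⟩
    · rwa [Finset.sdiff_sdiff_eq_self hX]
    · rw [he, Sym2.eq_swap]
    · rw [Finset.sdiff_sdiff_eq_self hX, dd_comm, hd]
  · exact ⟨X, hX, hs, x, hx, y, hy, he, ha, hd⟩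

theorem CB.lift {S S₁ : Finset V} {s : V} {e : Sym2 V} (h1 : S₁ ⊆ S)
    (hu : ∀ Z, Z ⊆ S₁ → dd G Z (S \ S₁) = ind (s ∈ Z)) (h : CB G S₁ e) : CB G S e := by
  obtain ⟨X, hX, hs, x, hx, y, hy, he, ha, hd⟩ := h.swap s
  rw [Finset.mem_sdiff] at hy
  exact ⟨X, hX.trans h1, x, hx, y, by simp [h1 hy.1, hy.2], he, ha,
    by rw [dd_piece h1 hu hX hs, hd]⟩

theorem CB.restrict {S S₁ : Finset V} {v w : V} (h1 : S₁ ⊆ S) (h : CB G S s(v, w))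
    (hv : v ∈ S₁) (hw : w ∈ S₁) : CB G S₁ s(v, w) := by
  obtain ⟨X, hX, x, hx, y, hy, he, ha, hd⟩ := h
  rw [Finset.mem_sdiff] at hy
  have hxy : x ∈ S₁ ∧ y ∈ S₁ := by
    rw [Sym2.eq_iff] at he
    rcases he with ⟨rfl, rfl⟩ | ⟨rfl, rfl⟩
    · exact ⟨hv, hw⟩
    · exact ⟨hw, hv⟩
  have hx1 : x ∈ X ∩ S₁ := by simp [hx, hxy.1]
  have hy1 : y ∈ S₁ \ (X ∩ S₁) := by simp [hxy.2, hy.2]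
  refine ⟨X ∩ S₁, Finset.inter_subset_right, x, hx1, y, hy1, he, ha, ?_⟩
  have e1 := dd_pos_of hx1 hy1 ha
  have e2 : dd G (X ∩ S₁) (S₁ \ (X ∩ S₁)) ≤ dd G X (S \ X) := by
    refine dd_mono Finset.inter_subset_left ?_
    intro z hz
    simp only [Finset.mem_sdiff, Finset.mem_inter] at hz ⊢
    exact ⟨h1 hz.1, fun hh => hz.2 ⟨hh, hz.1⟩⟩
  omega

theorem conn_piece {S S₁ : Finset V} {s : V} (h1 : S₁ ⊆ S) (hs : s ∈ S)
    (hu : ∀ Z, Z ⊆ S₁ → dd G Z (S \ S₁) = ind (s ∈ Z))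
    (hc : ∀ X, X ⊆ S → X.Nonempty → X ≠ S → 1 ≤ dd G X (S \ X)) :
    ∀ X, X ⊆ S₁ → X.Nonempty → X ≠ S₁ → 1 ≤ dd G X (S₁ \ X) := by
  have key : ∀ X, X ⊆ S₁ → X.Nonempty → s ∉ X → 1 ≤ dd G X (S₁ \ X) := by
    intro X hX hX1 hsX
    rw [← dd_piece h1 hu hX hsX]
    exact hc X (hX.trans h1) hX1 (fun hh => hsX (hh ▸ hs))
  intro X hX hX1 hX2
  by_cases hsX : s ∈ X
  · have := key (S₁ \ X) Finset.sdiff_subset (sdiff_nonempty' hX hX2) (by simp [hsX])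
    rwa [Finset.sdiff_sdiff_eq_self hX, dd_comm] at this
  · exact key X hX hX1 hsX

theorem CB.mem {S : Finset V} {e : Sym2 V} (h : CB G S e) : ∀ v ∈ e, v ∈ S := by
  obtain ⟨X, hX, x, hx, y, hy, rfl, ha, hd⟩ := h
  intro v hv
  rw [Finset.mem_sdiff] at hy
  rcases Sym2.mem_iff.1 hv with rfl | rfl
  · exact hX hx
  · exact hy.1

theorem Blk.cover {S : Finset V} (hB : Blk G S) (hdeg : ∀ v ∈ S, dd G {v} S ≤ 3) {x : V}
    (hx : x ∈ S) (hne : S ≠ {x}) : ∃ c : ℕ, CC G S c ∧ 4 * (c : ℤ) ≤ W G S + 6 := by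
  have h2 := hB.deg hx hne
  obtain ⟨x', hx', d, hd, hxd⟩ := dd_pos (G := G) (X := {x}) (Y := S) (by omega)
  obtain rfl : x' = x := by simpa using hx'
  have hC : Chain (G.deleteEdges {s(x', d)}) S x' d := by
    refine ⟨hx, hd, ?_, ?_⟩
    · intro v hv
      have e1 := dd_delete hxd {v} S
      have e2 := hdeg v hv
      have e3 : ind (x' ∈ ({v} : Finset V) ∧ d ∈ S) = ind (v = x') := by
        congr 1; simp [hd, eq_comm]
      have e4 : ind (d ∈ ({v} : Finset V) ∧ x' ∈ S) = ind (v = d) := by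
        congr 1; simp [hx, eq_comm]
      omega
    · intro X hX hX1 hX2
      have e1 := dd_delete hxd X (S \ X)
      have e2 := hB X hX hX1 hX2
      have e3 : ind (x' ∈ X ∧ d ∈ S \ X) + ind (d ∈ X ∧ x' ∈ S \ X) =
          ind (¬ (x' ∈ X ↔ d ∈ X)) := by
        by_cases p : x' ∈ X <;> by_cases q : d ∈ X <;> simp [p, q, ind, hx, hd]
      omega
  obtain ⟨p, h1, h3⟩ := hC.path
  have hP := (h1.mono (deleteEdges_le _)).close hxd
  refine ⟨_, hP, ?_⟩
  have e1 := dd_delete hxd S S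
  rw [ind_true ⟨hx, hd⟩, ind_true ⟨hd, hx⟩] at e1
  unfold W at h3 ⊢
  push_cast
  omega

theorem top_level (n : ℕ) : ∀ S : Finset V, S.card = n → S.Nonempty →
    (∀ X, X ⊆ S → X.Nonempty → X ≠ S → 1 ≤ dd G X (S \ X)) →
    (∀ v ∈ S, dd G {v} S ≤ 3) →
    ∃ (c : ℕ) (B : Finset (Sym2 V)) (Z : Finset V), CC G S c ∧ (∀ e ∈ B, CB G S e) ∧
      (∀ v ∈ S, (∀ w ∈ S, G.Adj v w → CB G S s(v, w)) → v ∈ Z) ∧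
      4 * (c : ℤ) + 6 * (Z.card : ℤ) ≤ W G S + 8 * (B.card : ℤ) + 6 := by
  induction n using Nat.strong_induction_on with
  | _ n ih =>
    intro S hS hne hc hdeg
    obtain ⟨x, hx⟩ := hne
    by_cases hSx : S = {x}
    · subst hSx
      exact ⟨1, ∅, {x}, CC.single x, by simp, fun v hv _ => hv, by rw [W_single]; simp⟩
    by_cases hB : Blk G S
    · obtain ⟨c, h1, h2⟩ := hB.cover hdeg hx hSx
      refine ⟨c, ∅, ∅, h1, by simp, ?_, by simpa using h2⟩
      intro v hv hw
      exfalso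
      have hSv : S ≠ {v} := by
        intro hh
        rw [hh] at hx
        exact hSx ((by simpa using hx : x = v) ▸ hh)
      have := hB.deg hv hSv
      obtain ⟨v', hv', d, hd, hvd⟩ := dd_pos (G := G) (X := {v}) (Y := S) (by omega)
      obtain rfl : v' = v := by simpa using hv'
      obtain ⟨X, hX, p, hp, q, hq, _, _, h4⟩ := hw d hd hvd
      have := hB X hX ⟨p, hp⟩ (by rintro rfl; simp at hq)
      omega
    · unfold Blk at hB
      push Not at hB
      obtain ⟨X, hX, hX1, hX2, hX3⟩ := hB
      have h1 : dd G X (S \ X) = 1 := by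
        have := hc X hX hX1 hX2
        omega
      obtain ⟨s, hs, t, ht, hst, u1, u2⟩ := unique_edge h1
      have hU : X ∪ S \ X = S := Finset.union_sdiff_of_subset hX
      have hD : Disjoint X (S \ X) := Finset.disjoint_sdiff
      have hcd := Finset.card_union_of_disjoint hD
      rw [hU] at hcd
      have c1 : 0 < X.card := Finset.card_pos.2 hX1
      have c2 : 0 < (S \ X).card := Finset.card_pos.2 ⟨t, ht⟩
      have hXX : S \ (S \ X) = X := Finset.sdiff_sdiff_eq_self hX
      have hY : S \ X ⊆ S := Finset.sdiff_subset
      have u2' : ∀ Z, Z ⊆ S \ X → dd G Z (S \ (S \ X)) = ind (t ∈ Z) := by rwa [hXX]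
      obtain ⟨k1, B1, Z1, A1, A2, A3, A4⟩ := ih X.card (by omega) X rfl hX1
        (conn_piece hX (hX hs) u1 hc)
        (fun v hv => (dd_mono le_rfl hX).trans (hdeg v (hX hv)))
      obtain ⟨k2, B2, Z2, C1, C2, C3, C4⟩ := ih (S \ X).card (by omega) (S \ X) rfl ⟨t, ht⟩
        (conn_piece hY (hY ht) u2' hc)
        (fun v hv => (dd_mono le_rfl hY).trans (hdeg v (hY hv)))
      have hB12 : Disjoint B1 B2 := by
        rw [Finset.disjoint_left]
        intro e h1 h2
        induction e using Sym2.ind with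
        | _ p q =>
          have m1 := (A2 _ h1).mem p (by simp)
          have m2 := (C2 _ h2).mem p (by simp)
          exact (Finset.mem_sdiff.1 m2).2 m1
      have hst1 : s(s, t) ∉ B1 ∪ B2 := by
        rw [Finset.mem_union]
        rintro (h | h)
        · exact (Finset.mem_sdiff.1 ht).2 ((A2 _ h).mem t (by simp))
        · exact (Finset.mem_sdiff.1 ((C2 _ h).mem s (by simp))).2 hs
      refine ⟨k1 + k2, insert s(s, t) (B1 ∪ B2), Z1 ∪ Z2, ?_, ?_, ?_, ?_⟩
      · have := A1.union C1 hD
        rwa [hU] at this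
      · intro e he
        rw [Finset.mem_insert, Finset.mem_union] at he
        rcases he with rfl | he | he
        · exact ⟨X, hX, s, hs, t, ht, rfl, hst, h1⟩
        · exact (A2 e he).lift hX u1
        · exact (C2 e he).lift hY u2'
      · intro v hv hw
        rw [Finset.mem_union]
        by_cases hvX : v ∈ X
        · exact Or.inl (A3 v hvX fun w hwX ha => (hw w (hX hwX) ha).restrict hX hvX hwX)
        · have hvY : v ∈ S \ X := by simp [hv, hvX]
          exact Or.inr (C3 v hvY fun w hwX ha => (hw w (hY hwX) ha).restrict hY hvY hwX)
      · have hW := W_union (G := G) hD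
        rw [hU, h1] at hW
        have f1 : (insert s(s, t) (B1 ∪ B2)).card = B1.card + B2.card + 1 := by
          rw [Finset.card_insert_of_notMem hst1, Finset.card_union_of_disjoint hB12]
        have f2 := Finset.card_union_le Z1 Z2
        rw [f1]
        push_cast at hW ⊢
        omega

theorem boundary {u v : V} (X : Finset V) (p : G.Walk u v) (hu : u ∈ X) (hv : v ∉ X) :
    ∃ x ∈ X, ∃ y, y ∉ X ∧ G.Adj x y := by
  obtain ⟨d, _, h1, h2⟩ := p.exists_boundary_dart (X : Set V) (by simpa using hu) (by simpa using hv)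
  exact ⟨d.fst, by simpa using h1, d.snd, by simpa using h2, d.adj⟩

theorem CB.isBridge [Fintype V] {e : Sym2 V} (h : CB G Finset.univ e) : G.IsBridge e := by
  obtain ⟨X, hX, x, hx, y, hy, rfl, ha, hd⟩ := h
  rw [isBridge_iff]
  rintro ⟨p⟩
  obtain ⟨a, ha1, b, hb, hab⟩ := boundary X p hx (Finset.mem_sdiff.1 hy).2
  have e1 := dd_delete ha X (Finset.univ \ X)
  rw [ind_true ⟨hx, hy⟩] at e1
  have e2 := dd_pos_of (Y := Finset.univ \ X) ha1 (by simp [hb]) hab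
  omega

theorem cb_of_isBridge [Fintype V] {v w : V} (ha : G.Adj v w) (h : G.IsBridge s(v, w)) :
    CB G Finset.univ s(v, w) := by
  rw [isBridge_iff] at h
  let X : Finset V := Finset.univ.filter fun z => (G.deleteEdges {s(v, w)}).Reachable v z
  have hv : v ∈ X := by simp [X]
  have hw : w ∉ X := by simp [X, h]
  refine ⟨X, Finset.subset_univ _, v, hv, w, by simp [hw], rfl, ha, ?_⟩
  have e1 := dd_delete ha X (Finset.univ \ X)
  rw [ind_true ⟨hv, by simp [hw]⟩, ind_false (fun hh => hw hh.1)] at e1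
  have e2 : dd (G.deleteEdges {s(v, w)}) X (Finset.univ \ X) = 0 := by
    by_contra hc
    obtain ⟨a, ha1, b, hb, hab⟩ := dd_pos (Nat.pos_of_ne_zero hc)
    apply (Finset.mem_sdiff.1 hb).2
    have : (G.deleteEdges {s(v, w)}).Reachable v a := by simpa [X] using ha1
    simpa [X] using this.trans hab.reachable
  omega

theorem final [Fintype V] (hdeg : ∀ v : V, dd G {v} Finset.univ = 3) (hconn : G.Connected) :
    ∃ (a : V) (T : G.Walk a a), (∀ u : V, u ∈ T.support) ∧
      (∀ e : Sym2 V, T.edges.count e ≤ 2) ∧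
      4 * T.length + 5 * ({v : V | ∀ e ∈ G.incidenceSet v, G.IsBridge e}.ncard) ≤
        5 * Fintype.card V + 10 * ({e : Sym2 V | G.IsBridge e}.ncard) := by
  have := hconn.nonempty
  have hcut : ∀ X : Finset V, X.Nonempty → X ≠ Finset.univ → ∃ x ∈ X, ∃ y, y ∉ X ∧ G.Adj x y := by
    rintro X ⟨x, hx⟩ hX
    have : ∃ y, y ∉ X := by
      by_contra hc
      push Not at hc
      exact hX (Finset.eq_univ_iff_forall.2 hc)
    obtain ⟨y, hy⟩ := this
    obtain ⟨p⟩ := hconn.preconnected x y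
    exact boundary X p hx hy
  obtain ⟨c, B, Z, h1, h2, h3, h4⟩ := top_level (G := G) _ Finset.univ rfl Finset.univ_nonempty
    (by
      intro X _ hX1 hX2
      obtain ⟨x, hx, y, hy, hxy⟩ := hcut X hX1 hX2
      exact dd_pos_of hx (by simp [hy]) hxy)
    (fun v _ => (hdeg v).le)
  obtain ⟨a, T, t1, t2, t3⟩ := h1.tour hcut
  refine ⟨a, T, fun u => (t1 u).2 (Finset.mem_univ u), t2, ?_⟩
  have w1 : dd G Finset.univ Finset.univ = 3 * Fintype.card V := by
    rw [dd_sum, Finset.sum_congr rfl fun v _ => hdeg v]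
    simp [mul_comm]
  have n1 : {v : V | ∀ e ∈ G.incidenceSet v, G.IsBridge e}.ncard ≤ Z.card := by
    rw [← Set.ncard_coe_finset]
    refine Set.ncard_le_ncard ?_ (Set.toFinite _)
    intro v hv
    refine h3 v (Finset.mem_univ v) fun w _ ha => cb_of_isBridge ha (hv _ ?_)
    exact (mem_incidenceSet G v w).2 ha
  have n2 : B.card ≤ {e : Sym2 V | G.IsBridge e}.ncard := by
    rw [← Set.ncard_coe_finset]
    exact Set.ncard_le_ncard (fun e he => (h2 e he).isBridge) (Set.toFinite _)
  unfold W at h4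
  rw [w1] at h4
  rw [Finset.card_univ] at h4 t3
  push_cast at h4
  omega

end top

end CubicTour

/-- Every connected cubic simple graph `G` on `n` vertices admits a tour of length at most
`(4/3 − 1/183711)·(n − n₀ + 2b)`, where `b` is the number of bridges of `G` and `n₀` is the
number of vertices of `G` all of whose incident edges are bridges. -/
theorem stmt2 {V : Type*} [Fintype V] [DecidableEq V]
    (G : SimpleGraph V) [DecidableRel G.Adj]
    (hcubic : ∀ v : V, G.degree v = 3)
    (hconn : G.Connected) :
    ∃ (a : V) (T : G.Walk a a),
      (∀ u : V, u ∈ T.support) ∧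
      (∀ e : Sym2 V, T.edges.count e ≤ 2) ∧
      (T.length : ℝ) ≤ (4 / 3 - 1 / 183711) *
        ((Fintype.card V : ℝ)
          - ({v : V | ∀ e ∈ G.incidenceSet v, G.IsBridge e}.ncard : ℝ)
          + 2 * ({e : Sym2 V | G.IsBridge e}.ncard : ℝ)) := by
  have hdeg : ∀ v : V, CubicTour.dd G {v} Finset.univ = 3 := by
    intro v
    rw [CubicTour.dd_nbrs, ← hcubic v, ← G.card_neighborFinset_eq_degree]
    congr 1
    ext w
    simp
  obtain ⟨a, T, h1, h2, h3⟩ := CubicTour.final hdeg hconn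
  refine ⟨a, T, h1, fun e => ?_, ?_⟩
  · convert h2 e
  · have h4 : 4 * (T.length : ℝ) +
        5 * ({v : V | ∀ e ∈ G.incidenceSet v, G.IsBridge e}.ncard : ℝ) ≤
        5 * (Fintype.card V : ℝ) + 10 * ({e : Sym2 V | G.IsBridge e}.ncard : ℝ) := by
      exact_mod_cast h3
    have h5 : (0 : ℝ) ≤ (T.length : ℝ) := by positivity
    linarith
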